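/- arXiv:1102.2555 — 2 statements merged into one kernel-verified Lean document; each statement's English description precedes it below -/
import Mathlib

section
/- Let a and b be linearly independent unit vectors in a finite-dimensional complex inner product space and let C1, C2 > 0. Then the Hermitian operator T = (1/C1)|a⟩⟨a| − (1/C2)|b⟩⟨b| has exactly one negative eigenvalue, and it equals [C2 − C1 − √((C2 − C1)² + 4 C1 C2 (1 − |⟨a,b⟩|²))] / (2 C1 C2). -/
open scoped InnerProductSpace

noncomputable section

/-- The rank-one operator `|a⟩⟨a| : x ↦ ⟨a, x⟩ • a`. -/
def rankOne {V : Type*} [NormedAddCommGroup V] [InnerProductSpace ℂ V] (a : V) :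
    V →ₗ[ℂ] V :=
  (LinearMap.toSpanSingleton ℂ V a).comp (innerₛₗ ℂ a)

theorem rankOne_apply_eq_inner_smul {V : Type*} [NormedAddCommGroup V] [InnerProductSpace ℂ V]
    (a x : V) : rankOne a x = ⟪a, x⟫_ℂ • a := rfl

/-- Linearly independent unit vectors have inner product of norm less than one. -/
theorem norm_inner_lt_one_of_linearIndependent {V : Type*} [NormedAddCommGroup V]
    [InnerProductSpace ℂ V] {a b : V} (ha : ‖a‖ = 1) (hb : ‖b‖ = 1)
    (hab : LinearIndependent ℂ ![a, b]) : ‖⟪a, b⟫_ℂ‖ < 1 := by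
  have hle : ‖⟪a, b⟫_ℂ‖ ≤ 1 := by simpa [ha, hb] using norm_inner_le_norm (𝕜 := ℂ) a b
  refine lt_of_le_of_ne hle fun h => ?_
  have ha0 : a ≠ 0 := by rintro rfl; simp at ha
  have hb0 : b ≠ 0 := by rintro rfl; simp at hb
  obtain ⟨r, -, hr⟩ := (norm_inner_eq_norm_iff (𝕜 := ℂ) ha0 hb0).1 (by rw [h, ha, hb, one_mul])
  have := (LinearIndependent.pair_iff.1 hab) r (-1) (by rw [hr]; simp)
  simp at this

/-- A negative eigenvalue of `p |a⟩⟨a| − q |b⟩⟨b|` is a root of the characteristic polynomial of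
the restriction to the span of `a` and `b`, and an eigenvector is a multiple of an explicit one. -/
theorem negative_eigenvector_rankOne_difference {V : Type*} [NormedAddCommGroup V]
    [InnerProductSpace ℂ V] {a b : V} (ha : ‖a‖ = 1) (hb : ‖b‖ = 1) {p q μ : ℝ} (hp : 0 < p)
    (hμ : μ < 0) {x : V} (hx0 : x ≠ 0)
    (hx : ((p : ℂ) • rankOne a - (q : ℂ) • rankOne b) x = (μ : ℂ) • x) :
    (q + μ) * (p - μ) = p * q * ‖⟪a, b⟫_ℂ‖ ^ 2 ∧
      ∃ c : ℂ, c • (((p * q : ℂ) * ⟪a, b⟫_ℂ) • a - ((q : ℂ) * (p - μ)) • b) = x := by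
  have haa : ⟪a, a⟫_ℂ = 1 := by simp [inner_self_eq_norm_sq_to_K, ha]
  have hbb : ⟪b, b⟫_ℂ = 1 := by simp [inner_self_eq_norm_sq_to_K, hb]
  have hss : ⟪b, a⟫_ℂ * ⟪a, b⟫_ℂ = (‖⟪a, b⟫_ℂ‖ : ℂ) ^ 2 := by
    rw [← inner_conj_symm b a, Complex.conj_mul']
  have hμ0 : (μ : ℂ) ≠ 0 := by exact_mod_cast hμ.ne
  have hpμ : (p : ℂ) - μ ≠ 0 := by exact_mod_cast (by linarith : (0 : ℝ) < p - μ).ne'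
  simp only [LinearMap.sub_apply, LinearMap.smul_apply, rankOne_apply_eq_inner_smul] at hx
  have e1 := congrArg (fun y => ⟪a, y⟫_ℂ) hx
  have e2 := congrArg (fun y => ⟪b, y⟫_ℂ) hx
  simp only [inner_sub_right, inner_smul_right, haa, hbb] at e1 e2
  have hα : ⟪a, x⟫_ℂ * (p - μ) = q * ⟪b, x⟫_ℂ * ⟪a, b⟫_ℂ := by linear_combination e1
  have hβ : ⟪b, x⟫_ℂ ≠ 0 := by
    intro h
    have h' : ⟪a, x⟫_ℂ = 0 := by simpa [h, hpμ] using hα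
    rw [h, h'] at hx
    exact smul_ne_zero hμ0 hx0 (by simpa using hx.symm)
  constructor
  · have : ((q : ℂ) + μ) * (p - μ) = p * q * (‖⟪a, b⟫_ℂ‖ : ℂ) ^ 2 := by
      apply mul_left_cancel₀ hβ
      linear_combination (-(p - μ : ℂ)) * e2 + p * ⟪b, a⟫_ℂ * hα + p * q * ⟪b, x⟫_ℂ * hss
    exact_mod_cast this
  · refine ⟨⟪b, x⟫_ℂ / ((p - μ) * μ), ?_⟩
    have hα' : ⟪a, x⟫_ℂ = q * ⟪b, x⟫_ℂ * ⟪a, b⟫_ℂ / (p - μ) := by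
      rw [eq_div_iff hpμ, hα]
    have hx' : x = (μ : ℂ)⁻¹ • ((p : ℂ) • ⟪a, x⟫_ℂ • a - (q : ℂ) • ⟪b, x⟫_ℂ • b) := by
      rw [hx, inv_smul_smul₀ hμ0]
    conv_rhs => rw [hx', hα']
    match_scalars <;> field_simp

/-- A root of the characteristic polynomial of the restriction of `p |a⟩⟨a| − q |b⟩⟨b|` to the span
of `a` and `b` satisfies the eigenvalue equation with an explicit vector. -/
theorem rankOne_difference_apply_eigenvector {V : Type*} [NormedAddCommGroup V]
    [InnerProductSpace ℂ V] {a b : V} (ha : ‖a‖ = 1) (hb : ‖b‖ = 1) {p q μ : ℝ}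
    (h : (q + μ) * (p - μ) = p * q * ‖⟪a, b⟫_ℂ‖ ^ 2) :
    ((p : ℂ) • rankOne a - (q : ℂ) • rankOne b)
        (((p * q : ℂ) * ⟪a, b⟫_ℂ) • a - ((q : ℂ) * (p - μ)) • b) =
      (μ : ℂ) • (((p * q : ℂ) * ⟪a, b⟫_ℂ) • a - ((q : ℂ) * (p - μ)) • b) := by
  have haa : ⟪a, a⟫_ℂ = 1 := by simp [inner_self_eq_norm_sq_to_K, ha]
  have hbb : ⟪b, b⟫_ℂ = 1 := by simp [inner_self_eq_norm_sq_to_K, hb]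
  have hss : ⟪b, a⟫_ℂ * ⟪a, b⟫_ℂ = (‖⟪a, b⟫_ℂ‖ : ℂ) ^ 2 := by
    rw [← inner_conj_symm b a, Complex.conj_mul']
  have hc : ((q : ℂ) + μ) * (p - μ) = p * q * (‖⟪a, b⟫_ℂ‖ : ℂ) ^ 2 := by exact_mod_cast h
  simp only [LinearMap.sub_apply, LinearMap.smul_apply, rankOne_apply_eq_inner_smul,
    inner_sub_right, inner_smul_right, haa, hbb]
  match_scalars
  · ring
  · linear_combination (q : ℂ) * hc - p * q ^ 2 * hss

/-- For linearly independent unit vectors `a, b` and `C1, C2 > 0`, the Hermitian operator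
`T = C1⁻¹ |a⟩⟨a| − C2⁻¹ |b⟩⟨b|` has exactly one negative eigenvalue (which is simple), equal to
`(C2 − C1 − √((C2 − C1)² + 4 C1 C2 (1 − |⟨a,b⟩|²))) / (2 C1 C2)`. -/
theorem unique_negative_eigenvalue_rankOne_difference
    {V : Type*} [NormedAddCommGroup V] [InnerProductSpace ℂ V] [FiniteDimensional ℂ V]
    (a b : V) (ha : ‖a‖ = 1) (hb : ‖b‖ = 1) (hab : LinearIndependent ℂ ![a, b])
    (C1 C2 : ℝ) (hC1 : 0 < C1) (hC2 : 0 < C2) :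
    let T : V →ₗ[ℂ] V := ((C1 : ℂ))⁻¹ • rankOne a - ((C2 : ℂ))⁻¹ • rankOne b
    let lam : ℝ := (C2 - C1 -
        Real.sqrt ((C2 - C1) ^ 2 + 4 * C1 * C2 * (1 - ‖⟪a, b⟫_ℂ‖ ^ 2))) / (2 * C1 * C2)
    lam < 0 ∧ Module.End.HasEigenvalue T ((lam : ℝ) : ℂ) ∧
      Module.finrank ℂ (Module.End.eigenspace T ((lam : ℝ) : ℂ)) = 1 ∧
      ∀ μ : ℝ, μ < 0 → Module.End.HasEigenvalue T ((μ : ℝ) : ℂ) → μ = lam := by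
  intro T lam
  have hs := norm_inner_lt_one_of_linearIndependent ha hb hab
  set s := ‖⟪a, b⟫_ℂ‖ with hsdef
  have hs0 : 0 ≤ s := norm_nonneg _
  have hd : 0 < 4 * C1 * C2 * (1 - s ^ 2) := by
    have : 0 < 1 - s ^ 2 := by nlinarith
    positivity
  set D := (C2 - C1) ^ 2 + 4 * C1 * C2 * (1 - s ^ 2) with hD
  have hlt : |C2 - C1| < √D := by
    rw [← Real.sqrt_sq_eq_abs]
    exact Real.sqrt_lt_sqrt (sq_nonneg _) (by linarith)
  have hsq : √D ^ 2 = D := Real.sq_sqrt (by nlinarith [sq_nonneg (C2 - C1)])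
  have hneg : lam < 0 :=
    div_neg_of_neg_of_pos (by linarith [le_abs_self (C2 - C1)]) (by positivity)
  have hquad (μ : ℝ) : (C2⁻¹ + μ) * (C1⁻¹ - μ) = C1⁻¹ * C2⁻¹ * s ^ 2 ↔
      C1 * C2 * μ ^ 2 - (C2 - C1) * μ - (1 - s ^ 2) = 0 := by
    field_simp
    constructor <;> intro h <;> linear_combination -h
  have hroot : C1 * C2 * lam ^ 2 - (C2 - C1) * lam - (1 - s ^ 2) = 0 := by
    have hl : 2 * C1 * C2 * lam = C2 - C1 - √D := mul_div_cancel₀ _ (by positivity)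
    have : 4 * C1 * C2 * (C1 * C2 * lam ^ 2 - (C2 - C1) * lam - (1 - s ^ 2)) = 0 := by
      linear_combination (2 * C1 * C2 * lam - (C2 - C1) - √D) * hl + hsq + hD
    exact (mul_eq_zero.1 this).resolve_left (by positivity)
  have hT : T = ((C1⁻¹ : ℝ) : ℂ) • rankOne a - ((C2⁻¹ : ℝ) : ℂ) • rankOne b := by
    simp only [T, Complex.ofReal_inv]
  have hp : 0 < C1⁻¹ := inv_pos.2 hC1
  have hq : 0 < C2⁻¹ := inv_pos.2 hC2
  obtain ⟨v, hv⟩ : ∃ v, v = (((C1⁻¹ : ℝ) * (C2⁻¹ : ℝ) : ℂ) * ⟪a, b⟫_ℂ) • a -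
      (((C2⁻¹ : ℝ) : ℂ) * ((C1⁻¹ : ℝ) - lam)) • b := ⟨_, rfl⟩
  have hTv : T v = (lam : ℂ) • v := by
    rw [hT, hv]
    exact rankOne_difference_apply_eigenvector ha hb ((hquad lam).2 hroot)
  have hv0 : v ≠ 0 := by
    intro h
    rw [hv, sub_eq_add_neg, ← neg_smul] at h
    have h2 := ((LinearIndependent.pair_iff.1 hab) _ _ h).2
    have h3 : C2⁻¹ * (C1⁻¹ - lam) = 0 := by exact_mod_cast neg_eq_zero.1 h2
    have : 0 < C2⁻¹ * (C1⁻¹ - lam) := mul_pos hq (by linarith)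
    exact this.ne' h3
  have hspan : Module.End.eigenspace T (lam : ℂ) = Submodule.span ℂ {v} := by
    apply le_antisymm
    · intro x hx
      rw [Module.End.mem_eigenspace_iff] at hx
      rcases eq_or_ne x 0 with rfl | hx0
      · exact zero_mem _
      rw [hT] at hx
      obtain ⟨c, hc⟩ := (negative_eigenvector_rankOne_difference ha hb hp hneg hx0 hx).2
      exact Submodule.mem_span_singleton.2 ⟨c, hv ▸ hc⟩
    · rw [Submodule.span_singleton_le_iff_mem]
      exact Module.End.mem_eigenspace_iff.2 hTv
  refine ⟨hneg, Module.End.hasEigenvalue_of_hasEigenvector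
    ⟨Module.End.mem_eigenspace_iff.2 hTv, hv0⟩, ?_, ?_⟩
  · rw [hspan, finrank_span_singleton hv0]
  · intro μ hμ h
    obtain ⟨x, hx⟩ := h.exists_hasEigenvector
    have hx' := hx.apply_eq_smul
    rw [hT] at hx'
    have hr := (hquad μ).1 (negative_eigenvector_rankOne_difference ha hb hp hμ hx.2 hx').1
    have hprod : (μ - lam) * (C1 * C2 * (μ + lam) - (C2 - C1)) = 0 := by
      linear_combination hr - hroot
    rcases mul_eq_zero.1 hprod with h | h
    · linarith
    · have h1 : C1 * C2 * (μ * lam) = -(1 - s ^ 2) := by linear_combination lam * h - hroot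
      have h2 : 0 < C1 * C2 * (μ * lam) := mul_pos (mul_pos hC1 hC2) (mul_pos_of_neg_of_neg hμ hneg)
      nlinarith

end
end

section
/- Let M, N1, N2 be natural numbers with N1 ≤ N2 and set N = M + N1 + N2. Then for every real q ∈ [0,1] (with the convention 0⁰ = 1), ∑_{k=0}^{N1} [(N−2k+1)·N1!·(M+N2)! / ((N−k+1)!·k!)] · ∑_{l=0}^{N1−k} C(N1−k, l)·C(M+N2−k+l, l)·q^l·(1−q)^{N1−l} = 1. -/
/-- The summand of the terminating well-poised sum evaluated in `sum_wellPoisedTerm`. -/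
noncomputable def wellPoisedTerm (m b l k : ℕ) : ℝ :=
  ((m : ℝ) + l + b - 2 * k + 1) * (m + l - k).factorial * (b - k + l).factorial /
    ((m + l + b - k + 1).factorial * k.factorial * (m - k).factorial * (b - k).factorial)

theorem sum_wellPoisedTerm_zero_partial (m b : ℕ) (hmb : m ≤ b) (j : ℕ) (hj : j ≤ m) :
    ∑ k ∈ Finset.range (j + 1), wellPoisedTerm m b 0 k =
      1 / (j.factorial * (m + b - j).factorial) := by
  induction j with
  | zero =>
    simp only [wellPoisedTerm, zero_add, Finset.range_one, Finset.sum_singleton, Nat.sub_zero,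
      add_zero, Nat.factorial_succ, Nat.factorial_zero]
    push_cast
    have : (m : ℝ) + b + 1 ≠ 0 := by positivity
    field_simp
    ring
  | succ j ih =>
    rw [Finset.sum_range_succ, ih (by omega)]
    obtain ⟨r, rfl⟩ := Nat.exists_eq_add_of_le hj
    obtain ⟨s, rfl⟩ := Nat.exists_eq_add_of_le (hj.trans hmb)
    simp only [wellPoisedTerm]
    rw [show j + 1 + r + (j + 1 + s) - j = j + r + s + 1 + 1 by omega,
      show j + 1 + r + (j + 1 + s) - (j + 1) = j + r + s + 1 by omega,
      show j + 1 + r + 0 + (j + 1 + s) - (j + 1) + 1 = j + r + s + 1 + 1 by omega,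
      show j + 1 + r + 0 - (j + 1) = r by omega,
      show j + 1 + r - (j + 1) = r by omega,
      show j + 1 + s - (j + 1) = s by omega]
    simp only [Nat.factorial_succ, add_zero]
    push_cast
    field_simp
    ring

theorem sum_wellPoisedTerm_succ_partial (m b l : ℕ) (hmb : m ≤ b) (j : ℕ) (hj : j ≤ m) :
    ∑ k ∈ Finset.range (j + 1), wellPoisedTerm m b (l + 1) k =
      (l + 1) * ∑ k ∈ Finset.range (j + 1), wellPoisedTerm m b l k +
        ((m : ℝ) - j) * ((b : ℝ) - j) * (m + l - j).factorial * (b - j + l).factorial /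
          (j.factorial * (m + l + b - j + 1).factorial * (m - j).factorial *
            (b - j).factorial) := by
  induction j with
  | zero =>
    simp only [wellPoisedTerm, zero_add, Finset.range_one, Finset.sum_singleton, Nat.sub_zero]
    rw [show m + (l + 1) + b + 1 = m + l + b + 1 + 1 by omega, ← add_assoc m, ← add_assoc b]
    simp only [Nat.factorial_succ, Nat.factorial_zero]
    push_cast
    field_simp
    ring
  | succ j ih =>
    rw [Finset.sum_range_succ, ih (by omega), Finset.sum_range_succ _ (j + 1)]
    obtain ⟨r, rfl⟩ := Nat.exists_eq_add_of_le hj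
    obtain ⟨s, rfl⟩ := Nat.exists_eq_add_of_le (hj.trans hmb)
    simp only [wellPoisedTerm]
    rw [show j + 1 + r + l - j = r + l + 1 by omega,
      show j + 1 + s - j + l = s + l + 1 by omega,
      show j + 1 + r + l + (j + 1 + s) - j + 1 = j + r + l + s + 1 + 1 + 1 by omega,
      show j + 1 + r - j = r + 1 by omega,
      show j + 1 + s - j = s + 1 by omega,
      show j + 1 + r + (l + 1) - (j + 1) = r + l + 1 by omega,
      show j + 1 + s - (j + 1) + (l + 1) = s + l + 1 by omega,
      show j + 1 + r + (l + 1) + (j + 1 + s) - (j + 1) + 1 = j + r + l + s + 1 + 1 + 1 by omega,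
      show j + 1 + r + l - (j + 1) = r + l by omega,
      show j + 1 + s - (j + 1) + l = s + l by omega,
      show j + 1 + r + l + (j + 1 + s) - (j + 1) + 1 = j + r + l + s + 1 + 1 by omega,
      show j + 1 + r - (j + 1) = r by omega,
      show j + 1 + s - (j + 1) = s by omega]
    simp only [Nat.factorial_succ]
    push_cast
    field_simp
    ring

theorem sum_wellPoisedTerm (m b l : ℕ) (hmb : m ≤ b) :
    ∑ k ∈ Finset.range (m + 1), wellPoisedTerm m b l k =
      l.factorial / (m.factorial * b.factorial) := by
  induction l with
  | zero => simp [sum_wellPoisedTerm_zero_partial m b hmb m le_rfl]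
  | succ l ih =>
    rw [sum_wellPoisedTerm_succ_partial m b l hmb m le_rfl, ih, Nat.factorial_succ l]
    push_cast
    ring

theorem coeff_eq_wellPoisedTerm (m b l k : ℕ) (hk : k ≤ m) (hb : m + l ≤ b) :
    (((m + l + b - 2 * k + 1) * (m + l).factorial * b.factorial : ℕ) : ℝ) /
        (((m + l + b - k + 1).factorial * k.factorial : ℕ) : ℝ) *
        (((m + l - k).choose l * (b - k + l).choose l : ℕ) : ℝ) =
      (m + l).factorial * b.factorial / (l.factorial * l.factorial) *
        wellPoisedTerm m b l k := by
  have h1 : (((m + l - k).choose l : ℕ) : ℝ) =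
      (m + l - k).factorial / (l.factorial * (m - k).factorial) := by
    rw [Nat.cast_choose ℝ (by omega), show m + l - k - l = m - k by omega]
  have h2 : (((b - k + l).choose l : ℕ) : ℝ) =
      (b - k + l).factorial / (l.factorial * (b - k).factorial) := by
    rw [Nat.cast_choose ℝ (by omega), Nat.add_sub_cancel]
  simp only [Nat.cast_mul, h1, h2, wellPoisedTerm]
  rw [Nat.cast_add, Nat.cast_sub (by omega)]
  push_cast
  field_simp

theorem sum_coeff_eq_choose (n b l : ℕ) (hl : l ≤ n) (hb : n ≤ b) :
    ∑ k ∈ Finset.range (n - l + 1),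
      (((n + b - 2 * k + 1) * n.factorial * b.factorial : ℕ) : ℝ) /
        (((n + b - k + 1).factorial * k.factorial : ℕ) : ℝ) *
        (((n - k).choose l * (b - k + l).choose l : ℕ) : ℝ) = n.choose l := by
  obtain ⟨m, rfl⟩ := Nat.exists_eq_add_of_le' hl
  rw [Nat.add_sub_cancel, Finset.sum_congr rfl fun k hk ↦ coeff_eq_wellPoisedTerm m b l k
    (by simpa [Nat.lt_succ_iff] using hk) hb, ← Finset.mul_sum,
    sum_wellPoisedTerm m b l (by omega), Nat.cast_choose ℝ hl, Nat.add_sub_cancel]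
  field_simp


/-- Normalization identity `∑_{k=0}^{N1} P_k(q) = 1` (with `N = M + N1 + N2` and the
convention `0⁰ = 1`). -/
theorem sum_Pk_eq_one
    (M N1 N2 : ℕ) (h12 : N1 ≤ N2) (q : ℝ) (hq : q ∈ Set.Icc (0 : ℝ) 1) :
    ∑ k ∈ Finset.range (N1 + 1),
      ((((M + N1 + N2) - 2 * k + 1) * N1.factorial * (M + N2).factorial : ℕ) : ℝ) /
          ((((M + N1 + N2) - k + 1).factorial * k.factorial : ℕ) : ℝ) *
        ∑ l ∈ Finset.range (N1 - k + 1),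
          (((N1 - k).choose l * (M + N2 - k + l).choose l : ℕ) : ℝ)
            * q ^ l * (1 - q) ^ (N1 - l) = 1 := by
  have hN : M + N1 + N2 = N1 + (M + N2) := by omega
  simp only [hN]
  have hb : N1 ≤ M + N2 := by omega
  generalize M + N2 = b at hb
  simp_rw [Finset.mul_sum]
  rw [Finset.sum_comm' (t' := Finset.range (N1 + 1)) (s' := fun l ↦ Finset.range (N1 - l + 1))
    (by intro k l; simp only [Finset.mem_range]; omega)]
  calc
    _ = ∑ l ∈ Finset.range (N1 + 1), q ^ l * (1 - q) ^ (N1 - l) * N1.choose l := by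
      refine Finset.sum_congr rfl fun l hl ↦ ?_
      rw [← sum_coeff_eq_choose N1 b l (by simpa [Nat.lt_succ_iff] using hl) hb, Finset.mul_sum]
      exact Finset.sum_congr rfl fun k _ ↦ by ring
    _ = 1 := by rw [← add_pow, add_sub_cancel, one_pow]
end
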